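/- arXiv:2211.10520 — 4 statements merged into one kernel-verified Lean document; each statement's English description precedes it below -/
import Mathlib

section
/- For every finite abelian group G, there exist positive integers n and d such that G is isomorphic to the multiplicative group of d-th powers of reduced residues modulo n, i.e., G ≅ {a^d : a ∈ (ℤ/nℤ)ˣ}, the image of the d-th power map on the unit group of ℤ/nℤ. -/
/-- A finite family of infinite sets has a system of distinct representatives. -/
theorem Set.exists_injective_forall_mem_of_infinite {ι α : Type*} [Finite ι] (s : ι → Set α)
    (hs : ∀ i, (s i).Infinite) : ∃ f : ι → α, Function.Injective f ∧ ∀ i, f i ∈ s i := by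
  classical
  cases nonempty_fintype ι
  choose t ht hcard using fun i => (hs i).exists_subset_card_eq (Fintype.card ι)
  obtain ⟨f, hf, hft⟩ := (Finset.all_card_le_biUnion_card_iff_exists_injective t).1 fun S => by
    obtain rfl | ⟨i, hi⟩ := S.eq_empty_or_nonempty
    · simp
    · calc S.card ≤ Fintype.card ι := S.card_le_univ
        _ = (t i).card := (hcard i).symm
        _ ≤ (S.biUnion t).card := Finset.card_le_card (Finset.subset_biUnion_of_mem t hi)
  exact ⟨f, hf, fun i => ht i (hft i)⟩

theorem Nat.infinite_setOfPred_prime_eq_mul_coprime_add_one {n m : ℕ} (hn : n ≠ 0) (hm : m ≠ 0) :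
    {p : ℕ | p.Prime ∧ ∃ u, u.Coprime m ∧ p = n * m * u + 1}.Infinite := by
  refine Set.infinite_of_forall_exists_gt fun N => ?_
  have hcop : (n * m + 1).Coprime (n * m * m) :=
    Nat.Coprime.mul_right (by simp) (Nat.Coprime.coprime_mul_left_right (k := n) (by simp))
  obtain ⟨p, hlt, hp, hmod⟩ := Nat.forall_exists_prime_gt_and_modEq (N + (n * m + 1))
    (mul_ne_zero (mul_ne_zero hn hm) hm) hcop
  obtain ⟨t, ht⟩ := (Nat.modEq_iff_dvd' (by omega)).1 hmod.symm
  refine ⟨p, ⟨hp, 1 + m * t, by simp, ?_⟩, by omega⟩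
  rw [Nat.sub_eq_iff_eq_add (by omega)] at ht
  rw [ht]
  ring

/-- Given finitely many positive integers `n i`, there are distinct primes `p i` and a single
exponent `d` such that the `d`-th powers modulo `p i` form a group of order `n i`. -/
theorem Nat.exists_injective_prime_div_gcd_eq {ι : Type*} [Finite ι] (n : ι → ℕ)
    (hn : ∀ i, n i ≠ 0) :
    ∃ (p : ι → ℕ) (d : ℕ), Function.Injective p ∧ (∀ i, (p i).Prime) ∧ 0 < d ∧
      ∀ i, (p i - 1) / (p i - 1).gcd d = n i := by
  classical
  cases nonempty_fintype ι
  set m := ∏ i, n i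
  have hm : m ≠ 0 := Finset.prod_ne_zero_iff.2 fun i _ => hn i
  obtain ⟨p, hp, hps⟩ := Set.exists_injective_forall_mem_of_infinite _
    fun i => Nat.infinite_setOfPred_prime_eq_mul_coprime_add_one (hn i) hm
  choose hprime u hu hpu using hps
  have hu0 : ∀ i, 0 < u i := fun i => Nat.pos_of_ne_zero fun h =>
    (hprime i).one_lt.ne' (by simp [hpu i, h])
  refine ⟨p, m * ∏ i, u i, hp, hprime,
    Nat.mul_pos (Nat.pos_of_ne_zero hm) (Finset.prod_pos fun i _ => hu0 i), fun i => ?_⟩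
  have hcop : (n i).Coprime (∏ j ∈ Finset.univ.erase i, u j) :=
    Nat.Coprime.prod_right fun j _ =>
      ((hu j).coprime_dvd_right (Finset.dvd_prod_of_mem n (Finset.mem_univ i))).symm
  have hsub : p i - 1 = m * u i * n i := by
    rw [hpu i, Nat.add_sub_cancel]
    ring
  rw [hsub, ← Finset.mul_prod_erase _ u (Finset.mem_univ i), ← mul_assoc, Nat.gcd_mul_left,
    hcop.gcd_eq_one, mul_one,
    Nat.mul_div_cancel_left _ (Nat.mul_pos (Nat.pos_of_ne_zero hm) (hu0 i))]

/-- The group of `d`-th powers in a product is the product of the groups of `d`-th powers. -/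
noncomputable def MulEquiv.piPowMonoidHomRange {ι : Type*} (M : ι → Type*)
    [∀ i, CommGroup (M i)] (d : ℕ) :
    (∀ i, (powMonoidHom d : M i →* M i).range) ≃*
      (powMonoidHom d : (∀ i, M i) →* ∀ i, M i).range :=
  let f : (∀ i, (powMonoidHom d : M i →* M i).range) →* ∀ i, M i :=
    MonoidHom.piMap fun i => (powMonoidHom d : M i →* M i).range.subtype
  have hf : Function.Injective f := fun _ _ h => funext fun i => Subtype.ext (congrFun h i)
  have hrange : f.range = (powMonoidHom d : (∀ i, M i) →* ∀ i, M i).range := by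
    ext x
    constructor
    · rintro ⟨y, rfl⟩
      choose z hz using fun i => (y i).2
      exact ⟨z, funext hz⟩
    · rintro ⟨z, rfl⟩
      exact ⟨fun i => ⟨z i ^ d, z i, rfl⟩, rfl⟩
  (MonoidHom.ofInjective hf).trans (MulEquiv.subgroupCongr hrange)

/-- Isomorphic groups have isomorphic groups of `d`-th powers. -/
noncomputable def MulEquiv.powMonoidHomRangeCongr {M N : Type*} [CommGroup M] [CommGroup N]
    (e : M ≃* N) (d : ℕ) :
    (powMonoidHom d : M →* M).range ≃* (powMonoidHom d : N →* N).range :=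
  (e.subgroupMap _).trans <| MulEquiv.subgroupCongr <| by
    ext x
    constructor
    · rintro ⟨_, ⟨y, rfl⟩, rfl⟩
      exact ⟨e y, (map_pow e y d).symm⟩
    · rintro ⟨y, rfl⟩
      exact ⟨e.symm y ^ d, ⟨e.symm y, rfl⟩, by simp⟩

/-- For every finite abelian group `G`, there exist positive integers `n` and `d` such that
`G` is isomorphic to the subgroup of `d`-th powers of the unit group of `ℤ/nℤ`. -/
theorem finite_abelian_group_iso_power_residues
    (G : Type*) [CommGroup G] [Finite G] :
    ∃ n d : ℕ, 0 < n ∧ 0 < d ∧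
      Nonempty (G ≃* (powMonoidHom d : (ZMod n)ˣ →* (ZMod n)ˣ).range) := by
  obtain ⟨ι, _, n, hn, ⟨e⟩⟩ := CommGroup.equiv_prod_multiplicative_zmod_of_finite G
  obtain ⟨p, d, hp, hprime, hd, hcard⟩ :=
    Nat.exists_injective_prime_div_gcd_eq n fun i => (zero_lt_one.trans (hn i)).ne'
  have hfact : ∀ i, Fact (p i).Prime := fun i => ⟨hprime i⟩
  have hcop : Pairwise (Function.onFun Nat.Coprime p) := fun i j hij =>
    (Nat.coprime_primes (hprime i) (hprime j)).2 (hp.ne hij)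
  refine ⟨∏ i, p i, d, Finset.prod_pos fun i _ => (hprime i).pos, hd, ⟨?_⟩⟩
  have hcyc : ∀ i, Multiplicative (ZMod (n i)) ≃*
      (powMonoidHom d : (ZMod (p i))ˣ →* (ZMod (p i))ˣ).range := fun i =>
    mulEquivOfCyclicCardEq <| by
      rw [IsCyclic.card_powMonoidHom_range, Nat.card_eq_fintype_card (α := (ZMod (p i))ˣ),
        ZMod.card_units, hcard i]
      exact (Nat.card_congr Multiplicative.toAdd).trans (Nat.card_zmod _)
  let crt : (ZMod (∏ i, p i))ˣ ≃* ∀ i, (ZMod (p i))ˣ :=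
    (Units.mapEquiv (ZMod.prodEquivPi p hcop).toMulEquiv).trans MulEquiv.piUnits
  exact e.trans <| (MulEquiv.piCongrRight hcyc).trans <|
    (MulEquiv.piPowMonoidHomRange _ d).trans (crt.symm.powMonoidHomRangeCongr d)
end

section
/- Suppose k ≥ 1 and m_1, …, m_k are integers satisfying m_i ≥ 2 and m_{i+1} ∣ m_i for 1 ≤ i < k, with m_k ≥ 2 as well. Then there exist pairwise distinct prime numbers p_1, …, p_k satisfying the congruences p_i ≡ 1 + m_1 m_i (mod m_1^2 m_i) for each 1 ≤ i ≤ k. -/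
theorem Nat.coprime_one_add_mul_sq_mul (a b : ℕ) : (1 + a * b).Coprime (a ^ 2 * b) := by
  have h : (1 + a * b).Coprime (a * b) := by simp
  rw [sq, mul_assoc]
  exact h.coprime_mul_right_right.mul_right h


/-- If `m 0, …, m k` are integers with `m i ≥ 2` and `m (i+1) ∣ m i`, then there exist
pairwise distinct primes `p 0, …, p k` with `p i ≡ 1 + m 0 * m i (mod (m 0)^2 * m i)`. -/
theorem exists_distinct_primes_in_progressions
    (k : ℕ) (m : Fin (k + 1) → ℕ)
    (hm : ∀ i, 2 ≤ m i)
    (hdvd : ∀ i : Fin k, m i.succ ∣ m i.castSucc) :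
    ∃ p : Fin (k + 1) → ℕ, Function.Injective p ∧
      ∀ i, (p i).Prime ∧ p i ≡ 1 + m 0 * m i [MOD (m 0) ^ 2 * m i] := by
  obtain ⟨φ, hφ, hP⟩ := Filter.extraction_forall_of_frequently
    (P := fun n p => p.Prime ∧
      p ≡ 1 + m 0 * m (Fin.ofNat (k + 1) n) [MOD (m 0) ^ 2 * m (Fin.ofNat (k + 1) n)])
    (fun n => Filter.frequently_atTop'.mpr fun N =>
      Nat.forall_exists_prime_gt_and_modEq N
        (mul_ne_zero (pow_ne_zero 2 (by have := hm 0; omega))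
          (by have := hm (Fin.ofNat (k + 1) n); omega))
        (Nat.coprime_one_add_mul_sq_mul _ _))
  refine ⟨fun i => φ i, hφ.injective.comp Fin.val_injective, fun i => ?_⟩
  simpa using hP i
end

section
/- Let m_1, …, m_k be integers with m_i ≥ 2 and m_{i+1} ∣ m_i for 1 ≤ i < k, and let p_1, …, p_k be distinct primes with p_i ≡ 1 + m_1 m_i (mod m_1^2 m_i). Write p_i − 1 = m_1 m_i (1 + m_1 u_i) with u_i ∈ ℤ, set y_i = 1 + m_1 u_i, and put d = m_1 y_1 y_2 ⋯ y_k. Then for each 1 ≤ i ≤ k one has gcd(p_i − 1, d) = m_1 y_i, and hence (p_i − 1)/gcd(p_i − 1, d) = m_i. -/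
theorem dvd_apply_zero_of_succ_dvd_castSucc {M : Type*} [Monoid M] {n : ℕ} {f : Fin (n + 1) → M}
    (h : ∀ i : Fin n, f i.succ ∣ f i.castSucc) (i : Fin (n + 1)) : f i ∣ f 0 :=
  Fin.induction dvd_rfl (fun j hj => (h j).trans hj) i

/-- With `m i ≥ 2`, `m (i+1) ∣ m i`, distinct primes `p i ≡ 1 + m 0 * m i (mod (m 0)^2 * m i)`,
`p i - 1 = m 0 * m i * y i` with `y i = 1 + m 0 * u i`, and `d = m 0 * ∏ y i`, one has
`gcd (p i - 1) d = m 0 * y i`, and hence `(p i - 1) / gcd (p i - 1) d = m i`. -/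
theorem gcd_eq_and_quotient_eq
    (k : ℕ) (m p u y : Fin (k + 1) → ℕ)
    (hm : ∀ i, 2 ≤ m i)
    (hdvd : ∀ i : Fin k, m i.succ ∣ m i.castSucc)
    (hp : ∀ i, (p i).Prime)
    (hinj : Function.Injective p)
    (hcong : ∀ i, p i ≡ 1 + m 0 * m i [MOD (m 0) ^ 2 * m i])
    (hy : ∀ i, y i = 1 + m 0 * u i)
    (hpy : ∀ i, p i - 1 = m 0 * m i * y i)
    (d : ℕ) (hd : d = m 0 * ∏ i, y i) :
    ∀ i, Nat.gcd (p i - 1) d = m 0 * y i ∧ (p i - 1) / Nat.gcd (p i - 1) d = m i := by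
  intro i
  have hmi : m i ∣ m 0 := dvd_apply_zero_of_succ_dvd_castSucc hdvd i
  have hcop : Nat.Coprime (m i) (∏ j ∈ Finset.univ.erase i, y j) :=
    Nat.Coprime.prod_right fun j _ => Nat.Coprime.coprime_dvd_left hmi (by simp [hy j])
  have hgcd : Nat.gcd (p i - 1) d = m 0 * y i := by
    rw [hpy i, hd, ← Finset.mul_prod_erase _ y (Finset.mem_univ i), mul_right_comm, ← mul_assoc,
      Nat.gcd_mul_left, hcop.gcd_eq_one, mul_one]
  have hpos : 0 < m 0 * y i :=
    Nat.mul_pos (zero_lt_two.trans_le (hm 0)) (by rw [hy i]; lia)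
  exact ⟨hgcd, by rw [hgcd, hpy i, mul_right_comm, Nat.mul_div_cancel_left _ hpos]⟩
end

section
/- Let m_1, …, m_k be integers with m_i ≥ 2 and m_{i+1} ∣ m_i for 1 ≤ i < k, and let p_1, …, p_k be distinct primes with p_i ≡ 1 + m_1 m_i (mod m_1^2 m_i). Write p_i − 1 = m_1 m_i y_i where y_i = 1 + m_1 u_i, and put d = m_1 y_1 ⋯ y_k and n = p_1 p_2 ⋯ p_k. Then ℤ/m_1ℤ × ℤ/m_2ℤ × ⋯ × ℤ/m_kℤ ≅ U_n^{(d)}, the group of d-th powers of units modulo n. -/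
/-- The `d`-th powers in a finite cyclic group of order `gcd (|G|, d) * r` form a cyclic group of
order `r`. -/
theorem nonempty_zmod_mulEquiv_range_powMonoidHom {G : Type*} [CommGroup G] [Finite G]
    [IsCyclic G] {d r : ℕ} (h : Nat.card G = (Nat.card G).gcd d * r) :
    Nonempty (Multiplicative (ZMod r) ≃* (powMonoidHom d : G →* G).range) := by
  refine ⟨mulEquivOfCyclicCardEq ?_⟩
  rw [IsCyclic.card_powMonoidHom_range]
  refine (Nat.card_zmod r).trans (Nat.div_eq_of_eq_mul_right ?_ h).symm
  exact Nat.gcd_pos_of_pos_left _ Nat.card_pos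

/-- The group of `d`-th powers of a product decomposes along the factors. -/
theorem nonempty_pi_mulEquiv_range_powMonoidHom {ι H : Type*} {A G : ι → Type*} [CommGroup H]
    [∀ i, CommGroup (A i)] [∀ i, CommGroup (G i)] (d : ℕ) (e : H ≃* ∀ i, G i)
    (h : ∀ i, Nonempty (A i ≃* (powMonoidHom d : G i →* G i).range)) :
    Nonempty ((∀ i, A i) ≃* (powMonoidHom d : H →* H).range) := by
  let f i := (h i).some
  let g : (∀ i, A i) →* H := e.symm.toMonoidHom.comp
    (MonoidHom.pi fun i ↦ ((Subgroup.subtype _).comp (f i).toMonoidHom).comp (Pi.evalMonoidHom A i))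
  have hg a i : e (g a) i = f i (a i) := by simp [g]
  have hinj : Function.Injective g := fun a b hab ↦ by
    funext i
    apply (f i).injective
    ext
    rw [← hg, ← hg, hab]
  have hrange : g.range = (powMonoidHom d : H →* H).range := by
    ext x
    constructor
    · rintro ⟨a, rfl⟩
      choose b hb using fun i ↦ (f i (a i)).2
      refine ⟨e.symm b, e.injective ?_⟩
      funext i
      rw [hg, ← hb]
      simp
    · rintro ⟨b, rfl⟩
      refine ⟨fun i ↦ (f i).symm ⟨e b i ^ d, e b i, rfl⟩, e.injective ?_⟩
      funext i
      rw [hg]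
      simp
  exact ⟨(MonoidHom.ofInjective hinj).trans (MulEquiv.subgroupCongr hrange)⟩

/-- With `m i ≥ 2`, `m (i+1) ∣ m i`, distinct primes `p i ≡ 1 + m 0 * m i (mod (m 0)^2 * m i)`,
`p i - 1 = m 0 * m i * y i` where `y i = 1 + m 0 * u i`, `d = m 0 * ∏ y i` and `n = ∏ p i`,
the group `ℤ/m_1ℤ × ⋯ × ℤ/m_kℤ` is isomorphic to the group of `d`-th powers of units
modulo `n`. -/
theorem prod_zmod_iso_powers_of_units
    (k : ℕ) (m p u y : Fin (k + 1) → ℕ)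
    (hm : ∀ i, 2 ≤ m i)
    (hdvd : ∀ i : Fin k, m i.succ ∣ m i.castSucc)
    (hp : ∀ i, (p i).Prime)
    (hinj : Function.Injective p)
    (hcong : ∀ i, p i ≡ 1 + m 0 * m i [MOD (m 0) ^ 2 * m i])
    (hy : ∀ i, y i = 1 + m 0 * u i)
    (hpy : ∀ i, p i - 1 = m 0 * m i * y i)
    (d n : ℕ) (hd : d = m 0 * ∏ i, y i) (hn : n = ∏ i, p i) :
    Nonempty ((∀ i, Multiplicative (ZMod (m i))) ≃*
      (powMonoidHom d : (ZMod n)ˣ →* (ZMod n)ˣ).range) := by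
  have hm0 i : m i ∣ m 0 := by
    induction i using Fin.induction with
    | zero => exact dvd_rfl
    | succ i ih => exact (hdvd i).trans ih
  have hcop i : (m i).Coprime (∏ j ∈ Finset.univ.erase i, y j) := by
    refine Nat.Coprime.coprime_dvd_left (hm0 i) (Nat.Coprime.prod_right fun j _ ↦ ?_)
    simp [hy]
  have hgcd i : (p i - 1).gcd d = m 0 * y i := by
    rw [hd, ← Finset.mul_prod_erase _ _ (Finset.mem_univ i), hpy, mul_right_comm, ← mul_assoc,
      Nat.gcd_mul_left, hcop i, mul_one]
  subst hn
  let e : (ZMod (∏ i, p i))ˣ ≃* ∀ i, (ZMod (p i))ˣ :=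
    (Units.mapEquiv (ZMod.prodEquivPi p fun i j hij ↦
      (Nat.coprime_primes (hp i) (hp j)).2 (hinj.ne hij)).toMulEquiv).trans MulEquiv.piUnits
  refine nonempty_pi_mulEquiv_range_powMonoidHom d e fun i ↦ ?_
  have : Fact (p i).Prime := ⟨hp i⟩
  refine nonempty_zmod_mulEquiv_range_powMonoidHom ?_
  rw [Nat.card_eq_fintype_card, ZMod.card_units, hgcd, hpy, mul_right_comm]
end
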